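/- arXiv:1512.02364 — 2 statements merged into one kernel-verified Lean document; each statement's English description precedes it below -/
import Mathlib

section
/- Let $c < 0$ and $n = -cl$ with $l \in \mathbb{N}$. Then the Shannon entropy $H_{n,c}$ is concave on $[0,-\frac{1}{c}]$, increasing on $[0,-\frac{1}{2c}]$, and decreasing on $[-\frac{1}{2c},-\frac{1}{c}]$. -/
/-- The basic probabilities `p_{n,k}^{[c]}(x)` for `c < 0`, `n = -c·l`:
`p_{n,k}^{[c]}(x) = C(l,k) (-cx)^k (1+cx)^{l-k}` for `k ≤ l`, and `0` for `k > l`. -/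
noncomputable def pneg (c : ℝ) (l : ℕ) (k : ℕ) (x : ℝ) : ℝ :=
  if k ≤ l then (Nat.choose l k : ℝ) * (-c * x) ^ k * (1 + c * x) ^ (l - k) else 0

/-- The Shannon entropy `H_{n,c}` (with the convention `0 log 0 = 0`;
note `Real.log 0 = 0` in Mathlib). -/
noncomputable def Hent (c : ℝ) (l : ℕ) (x : ℝ) : ℝ :=
  -∑' k : ℕ, pneg c l k x * Real.log (pneg c l k x)

open Real Polynomial Finset

lemma bernsteinPolynomial.derivative_sum_C_mul (a : ℕ → ℝ) (n : ℕ) :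
    derivative (∑ k ∈ range (n + 2), C (a k) * bernsteinPolynomial ℝ (n + 1) k) =
      C ((n : ℝ) + 1) *
        ∑ k ∈ range (n + 1), C (a (k + 1) - a k) * bernsteinPolynomial ℝ n k := by
  have hshift := (sum_range_succ' (fun k ↦ C (a k) * bernsteinPolynomial ℝ n k) (n + 1)).symm.trans
    (sum_range_succ (fun k ↦ C (a k) * bernsteinPolynomial ℝ n k) (n + 1))
  rw [bernsteinPolynomial.eq_zero_of_lt ℝ n.lt_succ_self, mul_zero, add_zero] at hshift
  rw [derivative_sum, sum_range_succ']
  simp only [derivative_C_mul, bernsteinPolynomial.derivative_succ_aux,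
    bernsteinPolynomial.derivative_zero, C_sub, sub_mul, sum_sub_distrib, ← hshift, C_add, C_1,
    map_natCast, add_tsub_cancel_right, Nat.cast_add, Nat.cast_one]
  simp only [mul_sub, sum_sub_distrib, mul_add, mul_sum, mul_left_comm (C _)]
  ring

lemma log_choose_succ_sub_log_choose {n k : ℕ} (hk : k < n) :
    log (n.choose (k + 1)) - log (n.choose k) = log (n - k) - log (k + 1) := by
  have h : (n.choose (k + 1) : ℝ) * (k + 1) = n.choose k * (n - k) := by
    rw [← Nat.cast_sub hk.le]
    exact_mod_cast Nat.choose_succ_right_eq n k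
  have h1 : (n.choose (k + 1) : ℝ) ≠ 0 := by exact_mod_cast (Nat.choose_pos hk).ne'
  have h2 : (n.choose k : ℝ) ≠ 0 := by exact_mod_cast (Nat.choose_pos hk.le).ne'
  have h3 : (n : ℝ) - k ≠ 0 := sub_ne_zero.2 (by exact_mod_cast hk.ne')
  have h4 : (k : ℝ) + 1 ≠ 0 := by positivity
  have := congrArg log h
  rw [log_mul h1 h4, log_mul h2 h3] at this
  linarith

lemma log_add_one_sub_log_le {x : ℝ} (hx : 0 < x) : log (x + 1) - log x ≤ 1 / x := by
  rw [← log_div (by positivity) hx.ne']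
  refine (log_le_sub_one_of_pos (by positivity)).trans_eq ?_
  field_simp
  ring

/-- A lower bound for the second difference of `k ↦ log (n + 2).choose k`. -/
lemma neg_le_second_difference_log_choose {n k : ℕ} (hk : k ≤ n) :
    -(((n : ℝ) + 2) / ((k + 1) * (n - k + 1))) ≤
      log ((n + 2).choose (k + 2)) - log ((n + 2).choose (k + 1)) -
        (log ((n + 2).choose (k + 1)) - log ((n + 2).choose k)) := by
  have hkn : (0 : ℝ) ≤ n - k := sub_nonneg.2 (by exact_mod_cast hk)
  rw [log_choose_succ_sub_log_choose (by lia), log_choose_succ_sub_log_choose (by lia)]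
  have h1 := log_add_one_sub_log_le (x := (k : ℝ) + 1) (by positivity)
  have h2 := log_add_one_sub_log_le (x := (n : ℝ) - k + 1) (by positivity)
  have h3 : 1 / ((k : ℝ) + 1) + 1 / ((n : ℝ) - k + 1) = (n + 2) / ((k + 1) * (n - k + 1)) := by
    field_simp
    ring
  push_cast
  rw [show (n : ℝ) + 2 - (k + 1) = n - k + 1 by ring,
    show (n : ℝ) + 2 - k = n - k + 1 + 1 by ring]
  linarith

lemma bernsteinPolynomial.eval_eq (n k : ℕ) (t : ℝ) :
    (bernsteinPolynomial ℝ n k).eval t = n.choose k * t ^ k * (1 - t) ^ (n - k) := by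
  simp [bernsteinPolynomial]

lemma bernsteinPolynomial.eval_nonneg (n k : ℕ) {t : ℝ} (h0 : 0 ≤ t) (h1 : t ≤ 1) :
    0 ≤ (bernsteinPolynomial ℝ n k).eval t := by
  have := sub_nonneg.2 h1
  rw [eval_eq]
  positivity

lemma bernsteinPolynomial.sum_eval (n : ℕ) (t : ℝ) :
    ∑ k ∈ range (n + 1), (bernsteinPolynomial ℝ n k).eval t = 1 := by
  rw [← eval_finsetSum, bernsteinPolynomial.sum, eval_one]

lemma bernsteinPolynomial.sum_mul_eval (n : ℕ) (t : ℝ) :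
    ∑ k ∈ range (n + 1), k * (bernsteinPolynomial ℝ n k).eval t = n * t := by
  simpa [eval_finsetSum] using congrArg (eval t) (bernsteinPolynomial.sum_smul ℝ n)

lemma bernsteinPolynomial.eval_add_two {n k : ℕ} (hk : k ≤ n) (t : ℝ) :
    t * (1 - t) * ((n + 2) * (n + 1) * (bernsteinPolynomial ℝ n k).eval t) =
      (k + 1) * (n - k + 1) * (bernsteinPolynomial ℝ (n + 2) (k + 1)).eval t := by
  obtain ⟨m, rfl⟩ := Nat.exists_eq_add_of_le hk
  have h1 : ((k + m + 2 : ℕ) : ℝ) * (k + m + 1).choose k =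
      (k + m + 2).choose (k + 1) * (k + 1 : ℕ) := by
    exact_mod_cast Nat.add_one_mul_choose_eq (k + m + 1) k
  have h2 : ((k + m).choose k : ℝ) * (k + m + 1 : ℕ) = (k + m + 1).choose k * (m + 1 : ℕ) := by
    have := Nat.choose_mul_succ_eq (k + m) k
    rw [show k + m + 1 - k = m + 1 by lia] at this
    exact_mod_cast this
  rw [eval_eq, eval_eq, show k + m - k = m by lia, show k + m + 2 - (k + 1) = m + 1 by lia]
  push_cast at h1 h2 ⊢
  linear_combination t ^ (k + 1) * (1 - t) ^ (m + 1) * ((k + m + 2) * h2 + (m + 1) * h1)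

/-- The Shannon entropy of the binomial distribution with parameters `n` and `t`. -/
noncomputable def binomialEntropy (n : ℕ) (t : ℝ) : ℝ :=
  ∑ k ∈ range (n + 1), negMulLog ((bernsteinPolynomial ℝ n k).eval t)

lemma negMulLog_pow (x : ℝ) (n : ℕ) : negMulLog (x ^ n) = -(n * x ^ n * log x) := by
  rw [negMulLog, log_pow]
  ring

lemma binomialEntropy_eq (n : ℕ) (t : ℝ) :
    binomialEntropy n t = n * binEntropy t -
      (∑ k ∈ range (n + 1), C (log (n.choose k)) * bernsteinPolynomial ℝ n k).eval t := by
  have hterm : ∀ k ∈ range (n + 1), negMulLog ((bernsteinPolynomial ℝ n k).eval t) =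
      -log t * (k * (bernsteinPolynomial ℝ n k).eval t) -
      log (1 - t) * (n * (bernsteinPolynomial ℝ n k).eval t -
        k * (bernsteinPolynomial ℝ n k).eval t) -
      log (n.choose k) * (bernsteinPolynomial ℝ n k).eval t := by
    intro k hk
    rw [bernsteinPolynomial.eval_eq, negMulLog_mul, negMulLog_mul, negMulLog_pow, negMulLog_pow,
      negMulLog, Nat.cast_sub (mem_range_succ_iff.1 hk)]
    ring
  rw [binomialEntropy, sum_congr rfl hterm, sum_sub_distrib, sum_sub_distrib, ← mul_sum, ← mul_sum,
    sum_sub_distrib, ← mul_sum, bernsteinPolynomial.sum_mul_eval, bernsteinPolynomial.sum_eval,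
    binEntropy_eq_negMulLog_add_negMulLog_one_sub, eval_finsetSum]
  simp only [eval_mul, eval_C, negMulLog]
  ring

lemma binomialEntropy_one_sub (n : ℕ) (t : ℝ) :
    binomialEntropy n (1 - t) = binomialEntropy n t := by
  rw [binomialEntropy, ← sum_flip]
  refine sum_congr rfl fun k hk ↦ ?_
  rw [← bernsteinPolynomial.flip ℝ n k (mem_range_succ_iff.1 hk)]
  simp [eval_comp]

lemma concaveOn_binomialEntropy (n : ℕ) : ConcaveOn ℝ (Set.Icc 0 1) (binomialEntropy n) := by
  rw [funext (binomialEntropy_eq n)]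
  match n with
  | 0 => simpa [bernsteinPolynomial] using concaveOn_const (0 : ℝ) (convex_Icc (0 : ℝ) 1)
  | 1 => simpa [sum_range_succ] using strictConcave_binEntropy.concaveOn
  | n + 2 =>
    set a : ℕ → ℝ := fun k ↦ log ((n + 2).choose k)
    set P := ∑ k ∈ range (n + 2 + 1), C (a k) * bernsteinPolynomial ℝ (n + 2) k
    have hP : derivative (derivative P) = C (((n : ℝ) + 2) * (n + 1)) *
        ∑ k ∈ range (n + 1),
          C (a (k + 2) - a (k + 1) - (a (k + 1) - a k)) * bernsteinPolynomial ℝ n k := by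
      have h1 : derivative P = _ := bernsteinPolynomial.derivative_sum_C_mul a (n + 1)
      rw [h1, derivative_C_mul,
        bernsteinPolynomial.derivative_sum_C_mul (fun k ↦ a (k + 1) - a k) n, ← mul_assoc, ← C_mul]
      push_cast
      ring_nf
    refine concaveOn_of_hasDerivWithinAt2_nonpos (convex_Icc 0 1)
      (f' := fun t ↦ (n + 2 : ℕ) * (log (1 - t) - log t) - (derivative P).eval t)
      (f'' := fun t ↦ (n + 2 : ℕ) * (-1 / (1 - t) - t⁻¹) - (derivative (derivative P)).eval t)
      (by fun_prop) ?_ ?_ ?_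
    all_goals
      intro t ht
      rw [interior_Icc] at ht
      have ht0 : 0 < t := ht.1
      have ht1 : 0 < 1 - t := sub_pos.2 ht.2
    · exact (((hasDerivAt_binEntropy ht0.ne' ht.2.ne).const_mul _).sub
        (P.hasDerivAt t)).hasDerivWithinAt
    · exact (((((hasDerivAt_id t).const_sub 1).log ht1.ne').sub
        (hasDerivAt_log ht0.ne')).const_mul _ |>.sub
        ((derivative P).hasDerivAt t)).hasDerivWithinAt
    · have hbound : ∀ k ∈ range (n + 1),
          -((n + 2) * (bernsteinPolynomial ℝ (n + 2) (k + 1)).eval t) ≤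
          t * (1 - t) * (((n + 2) * (n + 1)) * ((a (k + 2) - a (k + 1) - (a (k + 1) - a k)) *
            (bernsteinPolynomial ℝ n k).eval t)) := by
        intro k hk
        have hkn := mem_range_succ_iff.1 hk
        have hkn' : (0 : ℝ) ≤ n - k := sub_nonneg.2 (by exact_mod_cast hkn)
        have hB := bernsteinPolynomial.eval_nonneg (n + 2) (k + 1) ht0.le ht.2.le
        have hmul := mul_le_mul_of_nonneg_right (neg_le_second_difference_log_choose hkn)
          (by positivity : 0 ≤ ((k : ℝ) + 1) * (n - k + 1) *
            (bernsteinPolynomial ℝ (n + 2) (k + 1)).eval t)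
        calc _ = -(((n : ℝ) + 2) / ((k + 1) * (n - k + 1))) * (((k : ℝ) + 1) * (n - k + 1) *
              (bernsteinPolynomial ℝ (n + 2) (k + 1)).eval t) := by field_simp
          _ ≤ _ := hmul
          _ = _ := by rw [← bernsteinPolynomial.eval_add_two hkn]; ring
      have hsum : ∑ k ∈ range (n + 1), (bernsteinPolynomial ℝ (n + 2) (k + 1)).eval t ≤ 1 := by
        rw [← bernsteinPolynomial.sum_eval (n + 2) t, sum_range_succ' _ (n + 2), sum_range_succ _ (n + 1)]
        have h0 := bernsteinPolynomial.eval_nonneg (n + 2) 0 ht0.le ht.2.le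
        have h1 := bernsteinPolynomial.eval_nonneg (n + 2) (n + 1 + 1) ht0.le ht.2.le
        linarith
      have htotal := sum_le_sum hbound
      rw [sum_neg_distrib, ← mul_sum, ← mul_sum, ← mul_sum] at htotal
      have heval : (derivative (derivative P)).eval t = (n + 2) * (n + 1) *
          ∑ k ∈ range (n + 1), (a (k + 2) - a (k + 1) - (a (k + 1) - a k)) *
            (bernsteinPolynomial ℝ n k).eval t := by
        rw [hP]
        simp only [eval_mul, eval_C, eval_finsetSum]
      rw [← heval] at htotal
      have hn : (0 : ℝ) ≤ n + 2 := by positivity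
      have hlower := mul_le_mul_of_nonneg_left hsum hn
      refine nonpos_of_mul_nonpos_right ?_ (mul_pos ht0 ht1)
      have hbin : t * (1 - t) * (((n + 2 : ℕ) : ℝ) * (-1 / (1 - t) - t⁻¹)) = -(n + 2) := by
        push_cast
        field_simp
        ring
      rw [mul_sub, hbin]
      linarith

lemma monotoneOn_binomialEntropy (n : ℕ) :
    MonotoneOn (binomialEntropy n) (Set.Icc 0 (1 / 2)) := by
  intro x hx y hy hxy
  have h := (concaveOn_binomialEntropy n).min_le_of_mem_Icc (x := x) (y := 1 - x) (z := y)
    ⟨hx.1, by linarith [hx.2]⟩ ⟨by linarith [hx.2], by linarith [hx.1]⟩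
    ⟨hxy, by linarith [hx.2, hy.2]⟩
  rwa [binomialEntropy_one_sub, min_self] at h

lemma antitoneOn_binomialEntropy (n : ℕ) :
    AntitoneOn (binomialEntropy n) (Set.Icc (1 / 2) 1) := by
  intro x hx y hy hxy
  rw [← binomialEntropy_one_sub n x, ← binomialEntropy_one_sub n y]
  exact monotoneOn_binomialEntropy n ⟨by linarith [hy.2], by linarith [hy.1]⟩
    ⟨by linarith [hx.2], by linarith [hx.1]⟩ (by linarith)

lemma Hent_eq_binomialEntropy (c : ℝ) (l : ℕ) (x : ℝ) :
    Hent c l x = binomialEntropy l (-c * x) := by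
  rw [Hent, tsum_eq_sum (s := range (l + 1)), binomialEntropy, ← sum_neg_distrib]
  · refine sum_congr rfl fun k hk ↦ ?_
    rw [bernsteinPolynomial.eval_eq, pneg, if_pos (mem_range_succ_iff.1 hk), negMulLog,
      show 1 - -c * x = 1 + c * x by ring, neg_mul (_ * _)]
  · intro k hk
    rw [pneg, if_neg (by simpa using hk), zero_mul]

theorem stmt3 (c : ℝ) (hc : c < 0) (l : ℕ) (hl : 0 < l) :
    ConcaveOn ℝ (Set.Icc 0 (-1 / c)) (Hent c l) ∧
    MonotoneOn (Hent c l) (Set.Icc 0 (-1 / (2 * c))) ∧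
    AntitoneOn (Hent c l) (Set.Icc (-1 / (2 * c)) (-1 / c)) := by
  have hc' : 0 < -c := neg_pos.2 hc
  have hfull : -c * (-1 / c) = 1 := by field_simp [hc.ne]
  have hhalf : -c * (-1 / (2 * c)) = 1 / 2 := by field_simp [hc.ne]
  have hmono : Monotone (-c * ·) := fun x y hxy ↦ mul_le_mul_of_nonneg_left hxy hc'.le
  have hmaps : ∀ u v : ℝ, Set.MapsTo (-c * ·) (Set.Icc u v) (Set.Icc (-c * u) (-c * v)) :=
    fun u v x hx ↦ ⟨hmono hx.1, hmono hx.2⟩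
  rw [show Hent c l = binomialEntropy l ∘ (-c * ·) from funext (Hent_eq_binomialEntropy c l)]
  refine ⟨?_, ?_, ?_⟩
  · refine ((concaveOn_binomialEntropy l).comp_linearMap
      (LinearMap.mulLeft ℝ (-c))).subset ?_ (convex_Icc _ _)
    have h := hmaps 0 (-1 / c)
    rwa [mul_zero, hfull] at h
  · refine (monotoneOn_binomialEntropy l).comp (hmono.monotoneOn _) ?_
    have h := hmaps 0 (-1 / (2 * c))
    rwa [mul_zero, hhalf] at h
  · refine (antitoneOn_binomialEntropy l).comp_MonotoneOn (hmono.monotoneOn _) ?_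
    have h := hmaps (-1 / (2 * c)) (-1 / c)
    rwa [hhalf, hfull] at h
end

section
/- Let $c < 0$ and $n = -cl$ with $l \in \mathbb{N}$, $l \ge 2$. Then the function $x \mapsto H_{n,c}(x) + \frac{n}{c}\left[cx\log x - (1+cx)\log(1+cx)\right]$ is convex on $[0,-\frac{1}{c}]$. -/
/-- The Bernstein operator of degree `n` applied to the coefficient sequence `a`, evaluated at `t`
through the de Casteljau recursion. -/
noncomputable def bernsteinSum : ℕ → (ℕ → ℝ) → ℝ → ℝ
  | 0, a, _ => a 0
  | n + 1, a, t => (1 - t) * bernsteinSum n a t + t * bernsteinSum n (fun k => a (k + 1)) t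

lemma bernsteinSum_add (n : ℕ) (a b : ℕ → ℝ) (t : ℝ) :
    bernsteinSum n (fun k => a k + b k) t = bernsteinSum n a t + bernsteinSum n b t := by
  induction n generalizing a b with
  | zero => rfl
  | succ n ih =>
    simp only [bernsteinSum]
    rw [ih, ih (fun k => a (k + 1)) (fun k => b (k + 1))]
    ring

lemma bernsteinSum_neg (n : ℕ) (a : ℕ → ℝ) (t : ℝ) :
    bernsteinSum n (fun k => -a k) t = -bernsteinSum n a t := by
  induction n generalizing a with
  | zero => rfl
  | succ n ih =>
    simp only [bernsteinSum]
    rw [ih, ih (fun k => a (k + 1))]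
    ring

lemma bernsteinSum_affine (n : ℕ) (α β t : ℝ) :
    bernsteinSum n (fun k => α * k + β) t = α * n * t + β := by
  induction n generalizing β with
  | zero => simp [bernsteinSum]
  | succ n ih =>
    simp only [bernsteinSum]
    have h : (fun k : ℕ => α * ((k + 1 : ℕ) : ℝ) + β) = fun k : ℕ => α * k + (α + β) := by
      funext k; push_cast; ring
    rw [h, ih, ih]
    push_cast; ring

lemma bernsteinSum_nonneg (n : ℕ) (a : ℕ → ℝ) (ha : ∀ k ≤ n, 0 ≤ a k) {t : ℝ}
    (h0 : 0 ≤ t) (h1 : t ≤ 1) : 0 ≤ bernsteinSum n a t := by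
  induction n generalizing a with
  | zero => exact ha 0 le_rfl
  | succ n ih =>
    exact add_nonneg
      (mul_nonneg (sub_nonneg.2 h1) (ih a fun k hk => ha k (by omega)))
      (mul_nonneg h0 (ih _ fun k hk => ha (k + 1) (by omega)))

lemma bernsteinSum_sub (n : ℕ) (a b : ℕ → ℝ) (t : ℝ) :
    bernsteinSum n (fun k => a k - b k) t = bernsteinSum n a t - bernsteinSum n b t := by
  simp only [sub_eq_add_neg]
  rw [bernsteinSum_add n a (fun k => -b k), bernsteinSum_neg]

lemma hasDerivAt_bernsteinSum (n : ℕ) (a : ℕ → ℝ) (t : ℝ) :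
    HasDerivAt (bernsteinSum n a)
      (n * bernsteinSum (n - 1) (fun k => a (k + 1) - a k) t) t := by
  induction n generalizing a with
  | zero => simpa [bernsteinSum] using hasDerivAt_const t (a 0)
  | succ n ih =>
    have h := (((hasDerivAt_const t (1 : ℝ)).sub (hasDerivAt_id t)).mul (ih a)).add
      ((hasDerivAt_id t).mul (ih fun k => a (k + 1)))
    refine h.congr_deriv ?_
    simp only [Nat.add_sub_cancel, id, Pi.sub_apply]
    cases n with
    | zero => simp [bernsteinSum]; ring
    | succ m =>
      have e : bernsteinSum (m + 1) (fun k => a (k + 1) - a k) t =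
        (1 - t) * bernsteinSum m (fun k => a (k + 1) - a k) t +
          t * bernsteinSum m (fun k => a (k + 1 + 1) - a (k + 1)) t := rfl
      have e' := bernsteinSum_sub (m + 1) (fun k => a (k + 1)) a t
      simp only [Nat.add_sub_cancel]
      push_cast
      linear_combination (-((m : ℝ) + 1)) * e - e'

/-- The Bernstein operator preserves convexity. -/
lemma convexOn_bernsteinSum (n : ℕ) (a : ℕ → ℝ)
    (ha : ∀ k, k + 2 ≤ n → 2 * a (k + 1) ≤ a k + a (k + 2)) :
    ConvexOn ℝ (Set.Icc 0 1) (bernsteinSum n a) := by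
  have hd := hasDerivAt_bernsteinSum n a
  refine convexOn_of_hasDerivWithinAt2_nonneg (convex_Icc 0 1)
    (fun t _ => (hd t).continuousAt.continuousWithinAt)
    (fun t _ => (hd t).hasDerivWithinAt)
    (fun t _ => ((hasDerivAt_bernsteinSum (n - 1)
      (fun k => a (k + 1) - a k) t).const_mul (n : ℝ)).hasDerivWithinAt) ?_
  intro t ht
  rw [interior_Icc] at ht
  match n, ha with
  | 0, _ => simp
  | 1, _ => simp
  | n + 2, ha =>
    refine mul_nonneg (by positivity) (mul_nonneg (by positivity)
      (bernsteinSum_nonneg _ _ (fun k hk => ?_) ht.1.le ht.2.le))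
    have := ha k (by omega)
    linarith

lemma bernsteinSum_eq_sum_antidiagonal (n : ℕ) (a : ℕ → ℝ) (t : ℝ) :
    bernsteinSum n a t = ∑ ij ∈ Finset.HasAntidiagonal.antidiagonal n,
      (n.choose ij.1 : ℝ) * (a ij.1 * t ^ ij.1 * (1 - t) ^ ij.2) := by
  induction n generalizing a with
  | zero => simp [bernsteinSum]
  | succ n ih =>
    rw [Finset.sum_antidiagonal_choose_succ_mul (fun i j => a i * t ^ i * (1 - t) ^ j)]
    simp only [bernsteinSum]
    rw [ih, ih, Finset.mul_sum, Finset.mul_sum]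
    congr 1
    · exact Finset.sum_congr rfl fun ij _ => by ring
    · refine Finset.sum_congr rfl fun ij hij => ?_
      rw [Nat.choose_symm_of_eq_add (Finset.HasAntidiagonal.mem_antidiagonal.1 hij).symm]
      ring

lemma bernsteinSum_eq_sum_range (n : ℕ) (a : ℕ → ℝ) (t : ℝ) :
    bernsteinSum n a t = ∑ k ∈ Finset.range (n + 1),
      (n.choose k : ℝ) * t ^ k * (1 - t) ^ (n - k) * a k := by
  rw [bernsteinSum_eq_sum_antidiagonal, Finset.Nat.sum_antidiagonal_eq_sum_range_succ_mk]
  exact Finset.sum_congr rfl fun k _ => by ring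

/-- Binomial coefficients are log-concave. -/
lemma choose_mul_choose_le_sq (n k : ℕ) (hk : k + 2 ≤ n) :
    n.choose k * n.choose (k + 2) ≤ n.choose (k + 1) ^ 2 := by
  have h1 := Nat.choose_succ_right_eq n k
  have h2 := Nat.choose_succ_right_eq n (k + 1)
  obtain ⟨m, rfl⟩ := Nat.exists_eq_add_of_le hk
  rw [show k + 2 + m - k = m + 2 by omega] at h1
  rw [show k + 2 + m - (k + 1) = m + 1 by omega] at h2
  generalize (k + 2 + m).choose k = x at *
  generalize (k + 2 + m).choose (k + 1) = y at *
  change (k + 2 + m).choose (k + 2) * (k + 2) = y * (m + 1) at h2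
  generalize (k + 2 + m).choose (k + 2) = z at *
  have h3 : (x * z) * ((m + 2) * (k + 2)) = y ^ 2 * ((k + 1) * (m + 1)) := by
    calc _ = (x * (m + 2)) * (z * (k + 2)) := by ring
      _ = _ := by rw [← h1, h2]; ring
  refine Nat.le_of_mul_le_mul_right (h3.trans_le ?_) (by positivity : 0 < (m + 2) * (k + 2))
  gcongr y ^ 2 * ?_
  nlinarith

lemma log_choose_concave (n k : ℕ) (hk : k + 2 ≤ n) :
    Real.log (n.choose k) + Real.log (n.choose (k + 2)) ≤ 2 * Real.log (n.choose (k + 1)) := by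
  have p0 : (0 : ℝ) < n.choose k := by exact_mod_cast Nat.choose_pos (by omega)
  have p2 : (0 : ℝ) < n.choose (k + 2) := by exact_mod_cast Nat.choose_pos (by omega)
  have h := Real.log_le_log (mul_pos p0 p2)
    (by exact_mod_cast choose_mul_choose_le_sq n k hk :
      (n.choose k * n.choose (k + 2) : ℝ) ≤ (n.choose (k + 1) : ℝ) ^ 2)
  rwa [Real.log_mul p0.ne' p2.ne', Real.log_pow] at h

lemma mul_log_mul_pow_mul_pow (C t s : ℝ) (hC : C ≠ 0) (i j : ℕ) :
    C * t ^ i * s ^ j * Real.log (C * t ^ i * s ^ j) =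
      C * t ^ i * s ^ j * (Real.log C + (i * Real.log t + j * Real.log s)) := by
  by_cases ht : t ^ i = 0
  · simp [ht]
  by_cases hs : s ^ j = 0
  · simp [hs]
  rw [Real.log_mul (mul_ne_zero hC ht) hs, Real.log_mul hC ht, Real.log_pow, Real.log_pow]
  ring

/-- Splitting the binomial entropy into its two-point part and a Bernstein polynomial. -/
lemma Hent_eq (c : ℝ) (l : ℕ) (x : ℝ) :
    Hent c l x = bernsteinSum l (fun k => -Real.log (l.choose k)) (-c * x)
      - l * ((-c * x) * Real.log (-c * x) + (1 + c * x) * Real.log (1 + c * x)) := by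
  unfold Hent
  rw [tsum_eq_sum (s := Finset.range (l + 1)) fun k hk => by
    have : ¬ k ≤ l := by simpa using hk
    simp [pneg, this]]
  have h : ∀ k ∈ Finset.range (l + 1), pneg c l k x * Real.log (pneg c l k x) =
      (l.choose k : ℝ) * (-c * x) ^ k * (1 - (-c * x)) ^ (l - k) *
        (Real.log (l.choose k) + ((Real.log (-c * x) - Real.log (1 + c * x)) * k
          + l * Real.log (1 + c * x))) := by
    intro k hk
    have hk' : k ≤ l := by simpa [Nat.lt_succ_iff] using hk
    have hC : (l.choose k : ℝ) ≠ 0 := by exact_mod_cast (Nat.choose_pos hk').ne'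
    rw [pneg, if_pos hk', mul_log_mul_pow_mul_pow _ _ _ hC, Nat.cast_sub hk',
      show 1 - -c * x = 1 + c * x by ring]
    ring
  rw [Finset.sum_congr rfl h, ← bernsteinSum_eq_sum_range l (fun k => Real.log (l.choose k) +
    ((Real.log (-c * x) - Real.log (1 + c * x)) * k + l * Real.log (1 + c * x))),
    bernsteinSum_add, bernsteinSum_affine, bernsteinSum_neg]
  ring

theorem stmt4 (c : ℝ) (hc : c < 0) (l : ℕ) (hl : 2 ≤ l) (n : ℝ) (hn : n = -c * l) :
    ConvexOn ℝ (Set.Icc 0 (-1 / c)) (fun x : ℝ =>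
      Hent c l x + n / c * (c * x * Real.log x
        - (1 + c * x) * Real.log (1 + c * x))) := by
  have hB := convexOn_bernsteinSum l
    (fun k => -Real.log (l.choose k) + (-Real.log (-c) * k + 0)) fun k hk => by
      have := log_choose_concave l k hk
      push_cast
      linarith
  have hcomp := hB.comp_linearMap (LinearMap.mulLeft ℝ (-c))
  have hsub : Set.Icc 0 (-1 / c) ⊆ LinearMap.mulLeft ℝ (-c) ⁻¹' Set.Icc 0 1 := by
    rintro x ⟨h0, h1⟩
    rw [le_div_iff_of_neg hc] at h1
    simp only [Set.mem_preimage, LinearMap.mulLeft_apply, Set.mem_Icc]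
    exact ⟨mul_nonneg (by linarith) h0, by linarith⟩
  refine (hcomp.subset hsub (convex_Icc _ _)).congr fun x _ => ?_
  have hnc : n / c = -l := by rw [hn, neg_mul, mul_comm, neg_div, mul_div_cancel_right₀ _ hc.ne]
  simp only [Function.comp_apply, LinearMap.mulLeft_apply]
  rw [bernsteinSum_add, bernsteinSum_affine, Hent_eq, hnc]
  rcases eq_or_ne x 0 with rfl | hx
  · simp
  · rw [Real.log_mul (neg_ne_zero.2 hc.ne) hx]
    ring
end
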